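/- arXiv:2012.15154 — 7 statements merged into one kernel-verified Lean document; each statement's English description precedes it below -/
import Mathlib

section
/- Let T be a K×K row-stochastic matrix (K ≥ 2) with first row (1,0,…,0), written in block form T = [[1, 0],[r, Q]]. If Q is irreducible and at least one ordinary agent puts nonzero trust in the stubborn agent (i.e., r has at least one strictly positive entry), then I−Q is invertible, the limit of T^n as n → ∞ exists, and it equals the block matrix [[1, 0],[(I−Q)^{-1} r, 0]]. -/
open Matrix

/-- The row sums of the powers of a nonnegative matrix with row sums at most `1` decrease. -/
lemma antitone_pow_mulVec_one {ι : Type*} [Fintype ι] [DecidableEq ι] {Q : Matrix ι ι ℝ}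
    (hQ : ∀ i j, 0 ≤ Q i j) (hQ1 : Q *ᵥ 1 ≤ 1) (i : ι) :
    Antitone fun n => ((Q ^ n) *ᵥ 1) i := by
  refine antitone_nat_of_succ_le fun n => ?_
  rw [pow_succ, ← mulVec_mulVec]
  exact Finset.sum_le_sum fun k _ =>
    mul_le_mul_of_nonneg_left (hQ1 k) (pow_apply_nonneg hQ n i k)

/-- A nonnegative irreducible matrix with row sums at most `1`, at least one of them less
than `1`, has powers tending to zero. -/
lemma tendsto_pow_zero_of_irreducible_substochastic {ι : Type*} [Fintype ι] [DecidableEq ι]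
    {Q : Matrix ι ι ℝ} (hQ : ∀ i j, 0 ≤ Q i j) (hQ1 : Q *ᵥ 1 ≤ 1)
    (hirr : ∀ i j, ∃ n, 1 ≤ n ∧ 0 < (Q ^ n) i j) (hlt : ∃ j, (Q *ᵥ 1) j < 1) :
    Filter.Tendsto (fun n => Q ^ n) Filter.atTop (nhds 0) := by
  obtain ⟨j, hj⟩ := hlt
  have hanti := antitone_pow_mulVec_one hQ hQ1
  have hle (n : ℕ) (i : ι) : ((Q ^ n) *ᵥ 1) i ≤ 1 := by
    simpa using hanti i (Nat.zero_le n)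
  have hex (i : ι) : ∃ n, ((Q ^ n) *ᵥ 1) i < 1 := by
    obtain ⟨n, -, hn⟩ := hirr i j
    refine ⟨n + 1, lt_of_lt_of_le ?_ (hle n i)⟩
    rw [pow_succ, ← mulVec_mulVec]
    exact Finset.sum_lt_sum
      (fun k _ => mul_le_mul_of_nonneg_left (hQ1 k) (pow_apply_nonneg hQ n i k))
      ⟨j, Finset.mem_univ j, mul_lt_mul_of_pos_left hj hn⟩
  choose f hf using hex
  let N := Finset.univ.sup f + 1
  have hN (i : ι) : ((Q ^ N) *ᵥ 1) i < 1 :=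
    (hanti i ((Finset.le_sup (Finset.mem_univ i)).trans (Nat.le_succ _))).trans_lt (hf i)
  obtain ⟨i₀, -, hi₀⟩ := Finset.exists_max_image Finset.univ (fun i => ((Q ^ N) *ᵥ 1) i)
    ⟨j, Finset.mem_univ j⟩
  set c := ((Q ^ N) *ᵥ 1) i₀
  have hnonneg (n : ℕ) (i : ι) : 0 ≤ ((Q ^ n) *ᵥ 1) i :=
    Finset.sum_nonneg fun k _ => mul_nonneg (pow_apply_nonneg hQ n i k) zero_le_one
  have hpow (k : ℕ) (i : ι) : ((Q ^ (N * k)) *ᵥ 1) i ≤ c ^ k := by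
    induction k generalizing i with
    | zero => simp
    | succ k ih =>
      rw [Nat.mul_succ, Nat.add_comm, pow_add, ← mulVec_mulVec]
      calc ((Q ^ N) *ᵥ ((Q ^ (N * k)) *ᵥ 1)) i
          ≤ ((Q ^ N) *ᵥ (c ^ k • 1)) i := Finset.sum_le_sum fun l _ =>
            mul_le_mul_of_nonneg_left (by simpa using ih l) (pow_apply_nonneg hQ N i l)
        _ = c ^ k * ((Q ^ N) *ᵥ 1) i := by simp [mulVec_smul]
        _ ≤ c ^ k * c := mul_le_mul_of_nonneg_left (hi₀ i (Finset.mem_univ i))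
            (pow_nonneg (hnonneg N i₀) k)
        _ = c ^ (k + 1) := (pow_succ c k).symm
  have hsub (i : ι) : Filter.Tendsto (fun k => ((Q ^ (N * k)) *ᵥ 1) i) Filter.atTop (nhds 0) :=
    squeeze_zero (fun k => hnonneg _ i) (fun k => hpow k i)
      (tendsto_pow_atTop_nhds_zero_of_lt_one (hnonneg N i₀) (hN i₀))
  have hsum (i : ι) : Filter.Tendsto (fun n => ((Q ^ n) *ᵥ 1) i) Filter.atTop (nhds 0) :=
    (tendsto_iff_tendsto_subseq_of_antitone (hanti i)
      (Filter.tendsto_id.const_mul_atTop' (Nat.succ_pos _))).2 (hsub i)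
  refine tendsto_pi_nhds.2 fun i => tendsto_pi_nhds.2 fun l =>
    squeeze_zero (fun n => pow_apply_nonneg hQ n i l) (fun n => ?_) (hsum i)
  simpa [mulVec, dotProduct] using Finset.single_le_sum
    (f := fun k => (Q ^ n) i k) (fun k _ => pow_apply_nonneg hQ n i k) (Finset.mem_univ l)

/-- If the powers of `Q` tend to zero, then `1 - Q` is invertible. -/
lemma isUnit_one_sub_of_tendsto_pow_zero {ι : Type*} [Fintype ι] [DecidableEq ι]
    {Q : Matrix ι ι ℝ} (h : Filter.Tendsto (fun n => Q ^ n) Filter.atTop (nhds 0)) :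
    IsUnit (1 - Q) := by
  rw [← mulVec_injective_iff_isUnit]
  refine (injective_iff_map_eq_zero (mulVecLin (1 - Q))).2 fun v hv => ?_
  have hfix : Q *ᵥ v = v := by
    simpa [sub_mulVec, sub_eq_zero, eq_comm] using hv
  have hpow (n : ℕ) : (Q ^ n) *ᵥ v = v := by
    induction n with
    | zero => simp
    | succ n ih => rw [pow_succ, ← mulVec_mulVec, hfix, ih]
  have hlim : Filter.Tendsto (fun n => (Q ^ n) *ᵥ v) Filter.atTop (nhds (0 *ᵥ v)) :=
    ((continuous_id.matrix_mulVec continuous_const).tendsto 0).comp h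
  simp only [hpow, zero_mulVec] at hlim
  exact tendsto_nhds_unique tendsto_const_nhds hlim

/-- **DeGroot model with a stubborn agent: convergence of powers of the trust matrix.**
`T` is a `(m+1) × (m+1)` row-stochastic matrix (so `K = m+1 ≥ 2` agents) whose first row is
`(1,0,…,0)`, written in block form `T = [[1, 0],[r, Q]]` where `r i = T (i+1) 0` and
`Q i j = T (i+1) (j+1)`.  If `Q` is irreducible and at least one entry of `r` is positive,
then `I - Q` is invertible and `T^n` converges to the block matrix `[[1,0],[(I-Q)⁻¹ r, 0]]`. -/
theorem degroot_stubborn_power_limit {m : ℕ} (hm : 1 ≤ m)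
    (T : Matrix (Fin (m + 1)) (Fin (m + 1)) ℝ)
    (hT_nonneg : ∀ i j, 0 ≤ T i j)
    (hT_rowsum : ∀ i, ∑ j, T i j = 1)
    (hT_first : ∀ j, T 0 j = if j = 0 then (1 : ℝ) else 0)
    (Q : Matrix (Fin m) (Fin m) ℝ) (hQ : ∀ i j, Q i j = T i.succ j.succ)
    (r : Fin m → ℝ) (hr : ∀ i, r i = T i.succ 0)
    (hQ_irred : ∀ i j, ∃ n, 1 ≤ n ∧ 0 < (Q ^ n) i j)
    (hr_pos : ∃ i, 0 < r i) :
    IsUnit (1 - Q) ∧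
      Filter.Tendsto (fun n => T ^ n) Filter.atTop
        (nhds (Matrix.of fun (i j : Fin (m + 1)) =>
          Fin.cases (motive := fun _ => ℝ)
            (if j = 0 then (1 : ℝ) else 0)
            (fun i' => if j = 0 then ((1 - Q)⁻¹ *ᵥ r) i' else 0) i)) := by
  have hrQ (i : Fin m) : r i + (Q *ᵥ 1) i = 1 := by
    simpa [mulVec, dotProduct, Fin.sum_univ_succ, hr, hQ] using hT_rowsum i.succ
  have hr_nonneg (i : Fin m) : 0 ≤ r i := hr i ▸ hT_nonneg _ _
  have hlim : Filter.Tendsto (fun n => Q ^ n) Filter.atTop (nhds 0) := by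
    refine tendsto_pow_zero_of_irreducible_substochastic
      (fun i j => hQ i j ▸ hT_nonneg _ _) (fun i => ?_) hQ_irred (hr_pos.imp fun i hi => ?_)
    · have := hrQ i
      have := hr_nonneg i
      simp only [Pi.one_apply]
      linarith
    · have := hrQ i
      linarith
  have hunit := isUnit_one_sub_of_tendsto_pow_zero hlim
  refine ⟨hunit, ?_⟩
  have hinv : (1 - Q)⁻¹ *ᵥ r = 1 := by
    have hr_eq : r = (1 - Q) *ᵥ 1 := by
      ext i
      simp [sub_mulVec, ← hrQ i]
    rw [hr_eq, mulVec_mulVec, nonsing_inv_mul _ ((isUnit_iff_isUnit_det _).1 hunit), one_mulVec]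
  have hzero (n : ℕ) (j : Fin (m + 1)) : (T ^ n) 0 j = if j = 0 then 1 else 0 := by
    induction n with
    | zero => simp [one_apply, eq_comm]
    | succ n ih => simp [pow_succ', mul_apply, hT_first, ih]
  have hsucc (n : ℕ) (i j : Fin m) : (T ^ n) i.succ j.succ = (Q ^ n) i j := by
    induction n generalizing j with
    | zero => simp [one_apply]
    | succ n ih => simp [pow_succ, mul_apply, Fin.sum_univ_succ, hT_first, ih, hQ]
  have hcol (n : ℕ) (i : Fin m) : (T ^ n) i.succ 0 = 1 - ((Q ^ n) *ᵥ 1) i := by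
    have hmem : T ∈ rowStochastic ℝ (Fin (m + 1)) :=
      mem_rowStochastic_iff_sum.2 ⟨hT_nonneg, hT_rowsum⟩
    have := sum_row_of_mem_rowStochastic (pow_mem hmem n) i.succ
    rw [Fin.sum_univ_succ] at this
    simp only [hsucc] at this
    simp only [mulVec, dotProduct, Pi.one_apply, mul_one]
    linarith
  refine tendsto_pi_nhds.2 fun i => tendsto_pi_nhds.2 fun j => ?_
  cases i using Fin.cases with
  | zero => simp [hzero]
  | succ i =>
    cases j using Fin.cases with
    | zero =>
      have hrow : Filter.Tendsto (fun n => (Q ^ n) *ᵥ 1) Filter.atTop (nhds (0 *ᵥ 1)) :=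
        ((continuous_id.matrix_mulVec continuous_const).tendsto 0).comp hlim
      simpa [hcol, hinv] using (tendsto_pi_nhds.1 hrow i).const_sub 1
    | succ j =>
      simpa [hsucc] using tendsto_pi_nhds.1 (tendsto_pi_nhds.1 hlim i) j
end

section
/- Let A be an M×M irreducible sub-stochastic matrix with at least one row sum strictly less than 1. Then for every n ≥ M, every row sum of A^n is strictly less than 1. -/
/-- The row sums of `A ^ (n + 1)` in terms of those of `A ^ n`. -/
theorem Matrix.sum_pow_succ_apply {ι R : Type*} [Fintype ι] [DecidableEq ι] [Semiring R]
    (A : Matrix ι ι R) (n : ℕ) (i : ι) :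
    ∑ j, (A ^ (n + 1)) i j = ∑ l, A i l * ∑ j, (A ^ n) l j := by
  simp_rw [pow_succ', Matrix.mul_apply, Finset.mul_sum]
  exact Finset.sum_comm

/-- A set of indices closed under the nonzero entries of `A` is closed under those of `A ^ n`. -/
theorem Matrix.mem_of_pow_apply_ne_zero {ι R : Type*} [Fintype ι] [DecidableEq ι] [Semiring R]
    {A : Matrix ι ι R} {S : Set ι} (hS : ∀ i ∈ S, ∀ j, A i j ≠ 0 → j ∈ S) {n : ℕ} {i j : ι}
    (hi : i ∈ S) (h : (A ^ n) i j ≠ 0) : j ∈ S := by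
  induction n generalizing j with
  | zero =>
    by_cases hij : i = j
    · exact hij ▸ hi
    · simp [hij] at h
  | succ n ih =>
    rw [pow_succ, Matrix.mul_apply] at h
    obtain ⟨l, -, hl⟩ := Finset.exists_ne_zero_of_sum_ne_zero h
    exact hS l (ih (left_ne_zero_of_mul hl)) j (right_ne_zero_of_mul hl)

section SubStochastic

variable {ι : Type*} [Fintype ι] [DecidableEq ι] {A : Matrix ι ι ℝ}

theorem Matrix.sum_pow_succ_apply_le (h_nonneg : ∀ i j, 0 ≤ A i j) (h_sub : ∀ i, ∑ j, A i j ≤ 1)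
    (n : ℕ) (i : ι) : ∑ j, (A ^ (n + 1)) i j ≤ ∑ j, (A ^ n) i j := by
  induction n generalizing i with
  | zero => simpa [Matrix.one_apply] using h_sub i
  | succ n ih =>
    rw [sum_pow_succ_apply A (n + 1), sum_pow_succ_apply A n]
    exact Finset.sum_le_sum fun l _ => mul_le_mul_of_nonneg_left (ih l) (h_nonneg i l)

theorem Matrix.sum_pow_apply_le_one (h_nonneg : ∀ i j, 0 ≤ A i j) (h_sub : ∀ i, ∑ j, A i j ≤ 1)
    (n : ℕ) (i : ι) : ∑ j, (A ^ n) i j ≤ 1 := by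
  induction n with
  | zero => simp [Matrix.one_apply]
  | succ n ih => exact (sum_pow_succ_apply_le h_nonneg h_sub n i).trans ih

theorem Matrix.sum_pow_succ_apply_le_sum (h_nonneg : ∀ i j, 0 ≤ A i j)
    (h_sub : ∀ i, ∑ j, A i j ≤ 1) (n : ℕ) (i : ι) :
    ∑ j, (A ^ (n + 1)) i j ≤ ∑ j, A i j := by
  rw [sum_pow_succ_apply]
  exact Finset.sum_le_sum fun l _ =>
    mul_le_of_le_one_right (h_nonneg i l) (sum_pow_apply_le_one h_nonneg h_sub n l)

theorem Matrix.sum_pow_apply_eq_one_of_succ (h_nonneg : ∀ i j, 0 ≤ A i j)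
    (h_sub : ∀ i, ∑ j, A i j ≤ 1) {n : ℕ} {i l : ι} (hi : ∑ j, (A ^ (n + 1)) i j = 1)
    (hl : A i l ≠ 0) : ∑ j, (A ^ n) l j = 1 := by
  refine (sum_pow_apply_le_one h_nonneg h_sub n l).eq_of_not_lt fun hlt => ?_
  have h : ∑ k, A i k * ∑ j, (A ^ n) k j < ∑ k, A i k :=
    Finset.sum_lt_sum
      (fun k _ => mul_le_of_le_one_right (h_nonneg i k) (sum_pow_apply_le_one h_nonneg h_sub n k))
      ⟨l, Finset.mem_univ l, mul_lt_of_lt_one_right ((h_nonneg i l).lt_of_ne' hl) hlt⟩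
  rw [← sum_pow_succ_apply, hi] at h
  exact (h_sub i).not_gt h

/-- The number of rows of `A ^ n` with sum `1` strictly decreases with `n` until it vanishes. -/
theorem Matrix.card_filter_sum_pow_eq_one_le (h_nonneg : ∀ i j, 0 ≤ A i j)
    (h_sub : ∀ i, ∑ j, A i j ≤ 1) (h_irred : ∀ i j, ∃ n, 1 ≤ n ∧ 0 < (A ^ n) i j)
    (h_row : ∃ i, ∑ j, A i j < 1) (n : ℕ) :
    (Finset.univ.filter fun i => ∑ j, (A ^ n) i j = 1).card ≤ Fintype.card ι - n := by
  induction n with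
  | zero => exact Finset.card_le_univ _
  | succ n ih =>
    have hsub : (Finset.univ.filter fun i => ∑ j, (A ^ (n + 1)) i j = 1) ⊆
        Finset.univ.filter fun i => ∑ j, (A ^ n) i j = 1 :=
      Finset.monotone_filter_right _ fun i _ hi =>
        (sum_pow_apply_le_one h_nonneg h_sub n i).antisymm
          (hi.ge.trans (sum_pow_succ_apply_le h_nonneg h_sub n i))
    rcases hsub.eq_or_ssubset with heq | hss
    · have hiff (i : ι) : ∑ j, (A ^ (n + 1)) i j = 1 ↔ ∑ j, (A ^ n) i j = 1 := by
        simpa using Finset.ext_iff.mp heq i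
      obtain ⟨k, hk⟩ := h_row
      rw [Finset.card_eq_zero.mpr (Finset.filter_eq_empty_iff.mpr fun i _ hi => ?_)]
      · exact Nat.zero_le _
      obtain ⟨m, -, hm⟩ := h_irred i k
      have hmem : k ∈ {i | ∑ j, (A ^ (n + 1)) i j = 1} :=
        mem_of_pow_apply_ne_zero (fun i hi l hl => (hiff l).mpr
          (sum_pow_apply_eq_one_of_succ h_nonneg h_sub hi hl)) hi hm.ne'
      exact ((sum_pow_succ_apply_le_sum h_nonneg h_sub n k).trans_lt hk).ne hmem
    · have := Finset.card_lt_card hss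
      omega

end SubStochastic


/-- **Row sums of high powers of an irreducible sub-stochastic matrix with a deficient row.**
If `A` is an `M × M` entrywise nonnegative matrix whose row sums are all at most `1`
(sub-stochastic), which is irreducible (for every pair `(i,j)` some power `A^n`, `n ≥ 1`, has a
positive `(i,j)` entry), and at least one row sum is strictly less than `1`, then for every
`n ≥ M`, every row sum of `A ^ n` is strictly less than `1`. -/
theorem rowsum_pow_lt_one_of_irreducible_substochastic {M : ℕ}
    (A : Matrix (Fin M) (Fin M) ℝ)
    (h_nonneg : ∀ i j, 0 ≤ A i j)
    (h_sub : ∀ i, ∑ j, A i j ≤ 1)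
    (h_irred : ∀ i j, ∃ n, 1 ≤ n ∧ 0 < (A ^ n) i j)
    (h_row : ∃ i, ∑ j, A i j < 1) :
    ∀ n, M ≤ n → ∀ i, ∑ j, (A ^ n) i j < 1 := by
  intro n hn i
  refine (Matrix.sum_pow_apply_le_one h_nonneg h_sub n i).lt_of_ne fun hi => ?_
  have hcard := Matrix.card_filter_sum_pow_eq_one_le h_nonneg h_sub h_irred h_row n
  rw [Fintype.card_fin, Nat.sub_eq_zero_of_le hn, Nat.le_zero, Finset.card_eq_zero] at hcard
  exact Finset.filter_eq_empty_iff.mp hcard (Finset.mem_univ i) hi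
end

section
/- In the RA model, suppose agent i puts some trust in agent j, i.e., T_{ij} > 0. If X_j[n] → 0 in probability as n → ∞ and E[X_i[n]²(1−X_i[n])²] → 0 as n → ∞, then X_i[n] → 0 in probability as well. -/
open MeasureTheory Filter

/-- **The Random Actions (RA) opinion-dynamics model.**
`K` agents; `α ∈ (0,1)`; `T` a `K × K` row-stochastic trust matrix.  On a probability space with
filtration `ℱ`, the opinion process `X n : Ω → Fin K → ℝ` takes values in `[0,1]^K` and is
adapted; the action process `A n` takes values in `{0,1}^K`, is `ℱ (n+1)`-measurable, and
conditionally on `ℱ n` its coordinates are independent Bernoulli with parameters `X n`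
(encoded by `hA_cond`: for every finite set `s` of agents,
`E[∏_{k ∈ s} A_k[n] | ℱ n] = ∏_{k ∈ s} X_k[n]` a.s.); the update rule is
`X[n+1] = (1-α) X[n] + α T A[n]`. -/
structure RAModel (K : ℕ) (Ω : Type*) [mΩ : MeasurableSpace Ω] (μ : Measure Ω) where
  α : ℝ
  T : Matrix (Fin K) (Fin K) ℝ
  ℱ : Filtration ℕ mΩ
  X : ℕ → Ω → Fin K → ℝ
  A : ℕ → Ω → Fin K → ℝ
  hα : α ∈ Set.Ioo (0 : ℝ) 1
  hT_nonneg : ∀ i j, 0 ≤ T i j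
  hT_rowsum : ∀ i, ∑ j, T i j = 1
  hX_mem : ∀ n ω k, X n ω k ∈ Set.Icc (0 : ℝ) 1
  hX_adapted : ∀ n, Measurable[ℱ n] (X n)
  hA_val : ∀ n ω k, A n ω k = 0 ∨ A n ω k = 1
  hA_meas : ∀ n, Measurable[ℱ (n + 1)] (A n)
  hA_cond : ∀ n (s : Finset (Fin K)),
    μ[fun ω => ∏ k ∈ s, A n ω k | ℱ n] =ᵐ[μ] fun ω => ∏ k ∈ s, X n ω k
  h_update : ∀ n ω k, X (n + 1) ω k = (1 - α) * X n ω k + α * ∑ j, T k j * A n ω j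

/-- A sequence of `[0,1]`-valued functions on a probability space that converges to `0` in measure
has integrals converging to `0`. -/
theorem tendsto_integral_zero_of_tendstoInMeasure {Ω : Type*} [MeasurableSpace Ω] {μ : Measure Ω}
    [IsProbabilityMeasure μ] {f : ℕ → Ω → ℝ} (hfm : ∀ n, Measurable (f n))
    (hf : ∀ n ω, f n ω ∈ Set.Icc (0 : ℝ) 1)
    (h : TendstoInMeasure μ f atTop (fun _ => (0 : ℝ))) :
    Tendsto (fun n => ∫ ω, f n ω ∂μ) atTop (nhds 0) := by
  rw [tendstoInMeasure_iff_measureReal_norm] at h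
  have hbound : ∀ ε : ℝ, 0 < ε → ∀ n,
      ∫ ω, f n ω ∂μ ≤ ε + μ.real {x | ε ≤ ‖f n x - 0‖} := by
    intro ε hε n
    have hS : MeasurableSet {x | ε ≤ ‖f n x - 0‖} :=
      measurableSet_le measurable_const ((hfm n).sub measurable_const).norm
    have hI : Integrable (Set.indicator {x | ε ≤ ‖f n x - 0‖} (1 : Ω → ℝ)) μ :=
      (integrable_const (1 : ℝ)).indicator hS
    calc ∫ ω, f n ω ∂μ
        ≤ ∫ ω, (ε + Set.indicator {x | ε ≤ ‖f n x - 0‖} 1 ω) ∂μ := by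
          refine integral_mono (Integrable.of_mem_Icc 0 1 (hfm n).aemeasurable
            (ae_of_all _ (hf n)))
            ((integrable_const _).add hI) fun ω => ?_
          by_cases hω : ω ∈ {x | ε ≤ ‖f n x - 0‖}
          · simp only [Set.indicator_of_mem hω, Pi.one_apply]
            linarith [(hf n ω).2]
          · simp only [Set.indicator_of_notMem hω, add_zero]
            simp only [Set.mem_ofPred_eq, not_le, sub_zero] at hω
            exact (le_abs_self _).trans hω.le
      _ = ε + μ.real {x | ε ≤ ‖f n x - 0‖} := by
          rw [integral_add (integrable_const _) hI,
            integral_indicator_one hS]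
          simp
  rw [Metric.tendsto_atTop]
  intro ε hε
  obtain ⟨N, hN⟩ := Metric.tendsto_atTop.1 (h (ε / 2) (half_pos hε)) (ε / 2) (half_pos hε)
  refine ⟨N, fun n hn => ?_⟩
  have h1 := hN n hn
  rw [Real.dist_0_eq_abs, abs_of_nonneg measureReal_nonneg] at h1
  rw [Real.dist_0_eq_abs, abs_of_nonneg (integral_nonneg fun ω => (hf n ω).1)]
  linarith [hbound (ε / 2) (half_pos hε) n]

/-- A sequence of functions whose second moments tend to `0` converges to `0` in measure. -/
theorem tendstoInMeasure_zero_of_tendsto_integral_sq {Ω : Type*} [MeasurableSpace Ω]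
    {μ : Measure Ω} [IsFiniteMeasure μ] {f : ℕ → Ω → ℝ}
    (hf : ∀ n, Integrable (fun ω => f n ω ^ 2) μ)
    (h : Tendsto (fun n => ∫ ω, f n ω ^ 2 ∂μ) atTop (nhds 0)) :
    TendstoInMeasure μ f atTop (fun _ => (0 : ℝ)) := by
  rw [tendstoInMeasure_iff_measureReal_norm]
  intro ε hε
  refine squeeze_zero (fun _ => measureReal_nonneg) (fun n => ?_)
    (by simpa using h.div_const (ε ^ 2))
  rw [le_div_iff₀' (by positivity)]
  refine le_trans (le_of_eq ?_)
    (mul_meas_ge_le_integral_of_nonneg (ae_of_all _ fun ω => sq_nonneg (f n ω)) (hf n) (ε ^ 2))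
  congr 3
  ext ω
  rw [sub_zero, Real.norm_eq_abs, ← sq_abs (f n ω), sq_le_sq₀ hε.le (abs_nonneg _)]

namespace RAModel

variable {K : ℕ} {Ω : Type*} [MeasurableSpace Ω] {μ : Measure Ω}

theorem measurable_X (M : RAModel K Ω μ) (n : ℕ) (k : Fin K) :
    Measurable fun ω => M.X n ω k :=
  (measurable_pi_apply k).comp ((M.hX_adapted n).mono (M.ℱ.le n) le_rfl)

theorem measurable_A (M : RAModel K Ω μ) (n : ℕ) (k : Fin K) :
    Measurable fun ω => M.A n ω k :=
  (measurable_pi_apply k).comp ((M.hA_meas n).mono (M.ℱ.le (n + 1)) le_rfl)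

theorem A_mem (M : RAModel K Ω μ) (n : ℕ) (ω : Ω) (k : Fin K) :
    M.A n ω k ∈ Set.Icc (0 : ℝ) 1 := by
  rcases M.hA_val n ω k with h | h <;> simp [h]

theorem integral_A [IsProbabilityMeasure μ] (M : RAModel K Ω μ) (n : ℕ) (k : Fin K) :
    ∫ ω, M.A n ω k ∂μ = ∫ ω, M.X n ω k ∂μ := by
  have h := M.hA_cond n {k}
  simp only [Finset.prod_singleton] at h
  rw [← integral_congr_ae h, integral_condExp]

theorem T_le_one (M : RAModel K Ω μ) (i j : Fin K) : M.T i j ≤ 1 :=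
  M.hT_rowsum i ▸ Finset.single_le_sum (fun k _ => M.hT_nonneg i k) (Finset.mem_univ j)

/-- If agent `j` plays `0`, the next opinion of agent `i` stays away from `1` by `α T i j`. -/
theorem mul_le_one_sub_X_succ (M : RAModel K Ω μ) {n : ℕ} {ω : Ω} {j : Fin K}
    (hA : M.A n ω j = 0) (i : Fin K) : M.α * M.T i j ≤ 1 - M.X (n + 1) ω i := by
  have hsum : M.T i j ≤ ∑ k, M.T i k * (1 - M.A n ω k) := by
    simpa [hA] using Finset.single_le_sum (f := fun k => M.T i k * (1 - M.A n ω k))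
      (fun k _ => mul_nonneg (M.hT_nonneg i k) (sub_nonneg.2 (M.A_mem n ω k).2))
      (Finset.mem_univ j)
  simp only [mul_sub, mul_one, Finset.sum_sub_distrib, M.hT_rowsum] at hsum
  rw [M.h_update]
  nlinarith [M.hα.1, M.hα.2, (M.hX_mem n ω i).2]

theorem X_succ_sq_le (M : RAModel K Ω μ) {i j : Fin K} (hij : 0 < M.T i j) (n : ℕ) (ω : Ω) :
    M.X (n + 1) ω i ^ 2 ≤
      M.X (n + 1) ω i ^ 2 * (1 - M.X (n + 1) ω i) ^ 2 / (M.α * M.T i j) ^ 2 + M.A n ω j := by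
  have hc : 0 < M.α * M.T i j := mul_pos M.hα.1 hij
  rcases M.hA_val n ω j with hA | hA
  · rw [hA, add_zero, le_div_iff₀ (by positivity)]
    gcongr
    exact M.mul_le_one_sub_X_succ hA i
  · rw [hA]
    obtain ⟨h0, h1⟩ := M.hX_mem (n + 1) ω i
    have : M.X (n + 1) ω i ^ 2 ≤ 1 := pow_le_one₀ h0 h1
    have : 0 ≤ M.X (n + 1) ω i ^ 2 * (1 - M.X (n + 1) ω i) ^ 2 / (M.α * M.T i j) ^ 2 := by
      positivity
    linarith

end RAModel

/-- **Propagation of convergence in probability through a trusted neighbor (Lemma 3).**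
In the RA model, if agent `i` puts positive trust in agent `j` (`T i j > 0`),
`X_j[n] → 0` in probability, and `E[X_i[n]² (1 - X_i[n])²] → 0`, then `X_i[n] → 0` in
probability as well. -/
theorem RA_conv_in_prob_propagates {K : ℕ} (hK : 1 ≤ K) {Ω : Type*} [MeasurableSpace Ω]
    {μ : Measure Ω} [IsProbabilityMeasure μ] (M : RAModel K Ω μ) (i j : Fin K)
    (hij : 0 < M.T i j)
    (hXj : TendstoInMeasure μ (fun n ω => M.X n ω j) atTop (fun _ => (0 : ℝ)))
    (hXi_ms : Tendsto (fun n => ∫ ω, (M.X n ω i) ^ 2 * (1 - M.X n ω i) ^ 2 ∂μ) atTop (nhds 0)) :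
    TendstoInMeasure μ (fun n ω => M.X n ω i) atTop (fun _ => (0 : ℝ)) := by
  have hsq (n : ℕ) : Integrable (fun ω => M.X n ω i ^ 2) μ :=
    Integrable.of_mem_Icc 0 1 ((M.measurable_X n i).pow_const 2).aemeasurable
      (ae_of_all _ fun ω => ⟨sq_nonneg _, pow_le_one₀ (M.hX_mem n ω i).1 (M.hX_mem n ω i).2⟩)
  have hms (n : ℕ) : Integrable (fun ω => M.X n ω i ^ 2 * (1 - M.X n ω i) ^ 2) μ := by
    refine Integrable.of_mem_Icc 0 1 (((M.measurable_X n i).pow_const 2).mul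
      ((measurable_const.sub (M.measurable_X n i)).pow_const 2)).aemeasurable
      (ae_of_all _ fun ω => ⟨by positivity, ?_⟩)
    obtain ⟨h0, h1⟩ := M.hX_mem n ω i
    exact mul_le_one₀ (pow_le_one₀ h0 h1) (sq_nonneg _)
      (pow_le_one₀ (sub_nonneg.2 h1) (by linarith))
  have hA (n : ℕ) : Integrable (fun ω => M.A n ω j) μ :=
    Integrable.of_mem_Icc 0 1 (M.measurable_A n j).aemeasurable
      (ae_of_all _ fun ω => M.A_mem n ω j)
  have hEXj := tendsto_integral_zero_of_tendstoInMeasure (fun n => M.measurable_X n j)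
    (fun n ω => M.hX_mem n ω j) hXj
  refine tendstoInMeasure_zero_of_tendsto_integral_sq hsq ((tendsto_add_atTop_iff_nat 1).1 ?_)
  refine squeeze_zero (fun n => integral_nonneg fun ω => sq_nonneg _) (fun n => ?_)
    (by simpa using (((tendsto_add_atTop_iff_nat 1).2 hXi_ms).div_const
      ((M.α * M.T i j) ^ 2)).add hEXj)
  calc ∫ ω, M.X (n + 1) ω i ^ 2 ∂μ
      ≤ ∫ ω, (M.X (n + 1) ω i ^ 2 * (1 - M.X (n + 1) ω i) ^ 2 / (M.α * M.T i j) ^ 2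
          + M.A n ω j) ∂μ :=
        integral_mono (hsq _) (((hms _).div_const _).add (hA n)) (M.X_succ_sq_le hij n)
    _ = _ := by
        rw [integral_add ((hms _).div_const _) (hA n), integral_div, M.integral_A]
end

section
/- In the RA model with a stubborn agent, the opinion dynamics leads to herding at the stubborn agent's value: for every ε > 0 and every agent k ∈ {1,…,K}, the probability P(X_k[n] > ε) converges to 0 as n → ∞; that is, every X_k[n] converges in probability to the stubborn agent's constant opinion 0. -/
open MeasureTheory Filter

/-- **The Random Actions (RA) model with a stubborn agent.**
`K = m + 1 ≥ 2` agents, agent `0` being the stubborn one; `α ∈ (0,1)`; `T` a row-stochastic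
trust matrix with first row `(1,0,…,0)`, written in block form `T = [[1,0],[r,Q]]` where
`r i = T (i+1) 0` and `Q i j = T (i+1) (j+1)`; `Q` is irreducible and `r` has a positive entry.
On a probability space with filtration `ℱ`, the opinion process `X n` takes values in `[0,1]^K`,
is adapted, and satisfies `X_0[n] = 0` a.s.; the action process `A n` takes values in `{0,1}^K`,
is `ℱ (n+1)`-measurable, satisfies `A_0[n] = 0` a.s., and conditionally on `ℱ n` its coordinates
are independent Bernoulli with parameters `X n` (encoded by `hA_cond`: for every finite set `s`
of agents, `E[∏_{k ∈ s} A_k[n] | ℱ n] = ∏_{k ∈ s} X_k[n]` a.s.); the update rule is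
`X[n+1] = (1-α) X[n] + α T A[n]`. -/
structure RAStubbornModel (m : ℕ) (Ω : Type*) [mΩ : MeasurableSpace Ω] (μ : Measure Ω) where
  α : ℝ
  T : Matrix (Fin (m + 1)) (Fin (m + 1)) ℝ
  ℱ : Filtration ℕ mΩ
  X : ℕ → Ω → Fin (m + 1) → ℝ
  A : ℕ → Ω → Fin (m + 1) → ℝ
  hα : α ∈ Set.Ioo (0 : ℝ) 1
  hT_nonneg : ∀ i j, 0 ≤ T i j
  hT_rowsum : ∀ i, ∑ j, T i j = 1
  hT_first : ∀ j, T 0 j = if j = 0 then (1 : ℝ) else 0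
  hQ_irred : ∀ i j : Fin m, ∃ n, 1 ≤ n ∧
    0 < ((Matrix.of fun (a b : Fin m) => T a.succ b.succ) ^ n) i j
  hr_pos : ∃ i : Fin m, 0 < T i.succ 0
  hX_mem : ∀ n ω k, X n ω k ∈ Set.Icc (0 : ℝ) 1
  hX_adapted : ∀ n, Measurable[ℱ n] (X n)
  hX_stub : ∀ n, ∀ᵐ ω ∂μ, X n ω 0 = 0
  hA_val : ∀ n ω k, A n ω k = 0 ∨ A n ω k = 1
  hA_meas : ∀ n, Measurable[ℱ (n + 1)] (A n)
  hA_stub : ∀ n, ∀ᵐ ω ∂μ, A n ω 0 = 0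
  hA_cond : ∀ n (s : Finset (Fin (m + 1))),
    μ[fun ω => ∏ k ∈ s, A n ω k | ℱ n] =ᵐ[μ] fun ω => ∏ k ∈ s, X n ω k
  h_update : ∀ n ω k, X (n + 1) ω k = (1 - α) * X n ω k + α * ∑ j, T k j * A n ω j

/-- Maximum principle: a nonnegative harmonic vector of a stochastic matrix whose state `0` is
reachable from the irreducible block of the other states vanishes if it vanishes at `0`. -/
lemma harmonic_eq_zero {m : ℕ} {T : Matrix (Fin (m + 1)) (Fin (m + 1)) ℝ}
    (hT : ∀ i j, 0 ≤ T i j) (hsum : ∀ i, ∑ j, T i j = 1)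
    (hirr : ∀ i j : Fin m, ∃ n, 1 ≤ n ∧
      0 < ((Matrix.of fun (a b : Fin m) => T a.succ b.succ) ^ n) i j)
    (hr : ∃ i : Fin m, 0 < T i.succ 0) {L : Fin (m + 1) → ℝ} (hL : ∀ k, 0 ≤ L k)
    (hL0 : L 0 = 0) (hharm : ∀ k, L k = ∑ j, T k j * L j) : ∀ k, L k = 0 := by
  obtain ⟨k₀, hk₀⟩ := Finite.exists_max L
  have step : ∀ i j, L i = L k₀ → 0 < T i j → L j = L k₀ := by
    intro i j hi hij
    have hzero : ∑ l, T i l * (L k₀ - L l) = 0 := by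
      simp only [mul_sub, Finset.sum_sub_distrib, ← Finset.sum_mul, hsum, ← hharm, hi]
      ring
    have hj := (Finset.sum_eq_zero_iff_of_nonneg fun l _ =>
      mul_nonneg (hT i l) (sub_nonneg.2 (hk₀ l))).1 hzero j (Finset.mem_univ j)
    rcases mul_eq_zero.1 hj with h | h <;> linarith
  suffices hmax : L k₀ = 0 from fun k => le_antisymm (hmax ▸ hk₀ k) (hL k)
  rcases Fin.eq_zero_or_eq_succ k₀ with h0 | ⟨a, ha⟩
  · rw [h0, hL0]
  have hQ : ∀ i j : Fin m, 0 ≤ (Matrix.of fun (a b : Fin m) => T a.succ b.succ) i j :=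
    fun i j => hT _ _
  have reach : ∀ n j, 0 < ((Matrix.of fun (a b : Fin m) => T a.succ b.succ) ^ n) a j →
      L j.succ = L k₀ := by
    intro n
    induction n with
    | zero =>
      intro j hj
      rcases eq_or_ne a j with rfl | hne
      · rw [ha]
      · simp [hne] at hj
    | succ n ih =>
      intro j hj
      rw [pow_succ, Matrix.mul_apply] at hj
      obtain ⟨b, -, hb⟩ := Finset.exists_lt_of_sum_lt (f := fun _ => (0 : ℝ)) (by simpa using hj)
      exact step b.succ j.succ (ih b (pos_of_mul_pos_left hb (hQ b j)))
        (pos_of_mul_pos_right hb (Matrix.pow_apply_nonneg hQ n a b))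
  obtain ⟨i, hi⟩ := hr
  obtain ⟨n, -, hn⟩ := hirr a i
  rw [← step i.succ 0 (reach n i hn) hi, hL0]

/-- The iterates of a vector `e` with values in `[0,1]` and `e 0 = 0` under the lazy version of an
absorbing stochastic matrix tend to `0`. -/
lemma tendsto_zero_of_lazy_recursion {m : ℕ} {T : Matrix (Fin (m + 1)) (Fin (m + 1)) ℝ} {α : ℝ}
    (hα : α ∈ Set.Ioo (0 : ℝ) 1) (hT : ∀ i j, 0 ≤ T i j) (hsum : ∀ i, ∑ j, T i j = 1)
    (hfirst : ∀ j, T 0 j = if j = 0 then (1 : ℝ) else 0)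
    (hirr : ∀ i j : Fin m, ∃ n, 1 ≤ n ∧
      0 < ((Matrix.of fun (a b : Fin m) => T a.succ b.succ) ^ n) i j)
    (hr : ∃ i : Fin m, 0 < T i.succ 0) {e : ℕ → Fin (m + 1) → ℝ} (he : ∀ n k, 0 ≤ e n k)
    (he1 : ∀ k, e 0 k ≤ 1) (he0 : e 0 0 = 0)
    (hrec : ∀ n k, e (n + 1) k = (1 - α) * e n k + α * ∑ j, T k j * e n j) (k : Fin (m + 1)) :
    Tendsto (fun n => e n k) atTop (nhds 0) := by
  obtain ⟨hα0, hα1⟩ := hα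
  let P : (Fin (m + 1) → ℝ) → Fin (m + 1) → ℝ :=
    fun v k => (1 - α) * v k + α * ∑ j, T k j * v j
  have hP : Monotone P := fun v w hvw k => add_le_add
    (mul_le_mul_of_nonneg_left (hvw k) (by linarith))
    (mul_le_mul_of_nonneg_left
      (Finset.sum_le_sum fun j _ => mul_le_mul_of_nonneg_left (hvw j) (hT k j)) hα0.le)
  let u : Fin (m + 1) → ℝ := fun k => if k = 0 then 0 else 1
  have hu1 : ∀ k, u k ≤ 1 := fun k => by simp only [u]; split_ifs <;> norm_num
  have hPu : P u ≤ u := by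
    intro k
    rcases eq_or_ne k 0 with rfl | hk
    · have : ∑ j, T 0 j * u j = 0 :=
        Finset.sum_eq_zero fun j _ => by by_cases hj : j = 0 <;> simp [u, hfirst, hj]
      simp only [P, this]
      simp [u]
    · have : ∑ j, T k j * u j ≤ 1 := (hsum k) ▸ Finset.sum_le_sum fun j _ =>
        mul_le_of_le_one_right (hT k j) (hu1 j)
      have := mul_le_mul_of_nonneg_left this hα0.le
      simp only [P, u, hk, if_false] at this ⊢
      linarith
  let v : ℕ → Fin (m + 1) → ℝ := fun n => P^[n] u
  have hv_succ : ∀ n, v (n + 1) = P (v n) := fun n => Function.iterate_succ_apply' P n u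
  have hv_anti : Antitone v := hP.antitone_iterate_of_map_le hPu
  have hev : ∀ n, e n ≤ v n := by
    intro n
    induction n with
    | zero =>
      intro k
      rcases eq_or_ne k 0 with rfl | hk
      · simp [v, u, he0]
      · simpa [v, u, hk] using he1 k
    | succ n ih =>
      rw [hv_succ, show e (n + 1) = P (e n) from funext (hrec n)]
      exact hP ih
  let L : Fin (m + 1) → ℝ := fun k => ⨅ n, v n k
  have hv0 : ∀ n k, 0 ≤ v n k := fun n k => (he n k).trans (hev n k)
  have hlim : ∀ k, Tendsto (fun n => v n k) atTop (nhds (L k)) := fun k =>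
    tendsto_atTop_ciInf (fun _ _ h => hv_anti h k) ⟨0, by rintro _ ⟨n, rfl⟩; exact hv0 n k⟩
  have hharm : ∀ k, L k = ∑ j, T k j * L j := by
    intro k
    have h1 : Tendsto (fun n => P (v n) k) atTop (nhds (P L k)) :=
      ((hlim k).const_mul _).add
        ((tendsto_finsetSum _ fun j _ => (hlim j).const_mul (T k j)).const_mul α)
    have h2 : Tendsto (fun n => P (v n) k) atTop (nhds (L k)) := by
      simpa only [hv_succ] using (tendsto_add_atTop_iff_nat 1).2 (hlim k)
    have h3 : (1 - α) * L k + α * ∑ j, T k j * L j = L k := tendsto_nhds_unique h1 h2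
    exact mul_left_cancel₀ hα0.ne' (by linarith)
  have hL0 : L 0 = 0 := by
    have : v 0 0 = 0 := by simp [v, u]
    exact le_antisymm
      (le_of_tendsto' (hlim 0) fun n => (hv_anti (Nat.zero_le n) 0).trans this.le)
      (ge_of_tendsto' (hlim 0) fun n => hv0 n 0)
  have hL := harmonic_eq_zero hT hsum hirr hr
    (fun k => ge_of_tendsto' (hlim k) fun n => hv0 n k) hL0 hharm
  exact squeeze_zero (fun n => he n k) (fun n => hev n k) (hL k ▸ hlim k)

namespace RAStubbornModel

variable {m : ℕ} {Ω : Type*} [mΩ : MeasurableSpace Ω] {μ : Measure Ω}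

lemma measurable_X (M : RAStubbornModel m Ω μ) (n : ℕ) (k : Fin (m + 1)) :
    Measurable fun ω => M.X n ω k :=
  (measurable_pi_apply k).comp ((M.hX_adapted n).mono (M.ℱ.le n) le_rfl)

lemma measurable_A (M : RAStubbornModel m Ω μ) (n : ℕ) (k : Fin (m + 1)) :
    Measurable fun ω => M.A n ω k :=
  (measurable_pi_apply k).comp ((M.hA_meas n).mono (M.ℱ.le (n + 1)) le_rfl)

lemma integrable_X [IsProbabilityMeasure μ] (M : RAStubbornModel m Ω μ) (n : ℕ)
    (k : Fin (m + 1)) : Integrable (fun ω => M.X n ω k) μ :=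
  .of_mem_Icc 0 1 (M.measurable_X n k).aemeasurable (.of_forall fun ω => M.hX_mem n ω k)

lemma integrable_A [IsProbabilityMeasure μ] (M : RAStubbornModel m Ω μ) (n : ℕ)
    (k : Fin (m + 1)) : Integrable (fun ω => M.A n ω k) μ :=
  .of_mem_Icc 0 1 (M.measurable_A n k).aemeasurable
    (.of_forall fun ω => by rcases M.hA_val n ω k with h | h <;> simp [h])

lemma integral_A [IsProbabilityMeasure μ] (M : RAStubbornModel m Ω μ) (n : ℕ)
    (k : Fin (m + 1)) : ∫ ω, M.A n ω k ∂μ = ∫ ω, M.X n ω k ∂μ := by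
  have h := M.hA_cond n {k}
  simp only [Finset.prod_singleton] at h
  rw [← integral_condExp (M.ℱ.le n), integral_congr_ae h]

lemma integral_X_succ [IsProbabilityMeasure μ] (M : RAStubbornModel m Ω μ) (n : ℕ)
    (k : Fin (m + 1)) : ∫ ω, M.X (n + 1) ω k ∂μ =
      (1 - M.α) * ∫ ω, M.X n ω k ∂μ + M.α * ∑ j, M.T k j * ∫ ω, M.X n ω j ∂μ := by
  have hA : ∀ j ∈ Finset.univ, Integrable (fun ω => M.T k j * M.A n ω j) μ :=
    fun j _ => (M.integrable_A n j).const_mul _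
  simp only [M.h_update]
  rw [integral_add ((M.integrable_X n k).const_mul _) ((integrable_finsetSum _ hA).const_mul _),
    integral_const_mul, integral_const_mul, integral_finsetSum _ hA]
  simp only [integral_const_mul, M.integral_A]

/-- The mean opinions tend to the stubborn agent's opinion `0`. -/
lemma tendsto_integral_X [IsProbabilityMeasure μ] (M : RAStubbornModel m Ω μ)
    (k : Fin (m + 1)) : Tendsto (fun n => ∫ ω, M.X n ω k ∂μ) atTop (nhds 0) := by
  refine tendsto_zero_of_lazy_recursion (e := fun n k => ∫ ω, M.X n ω k ∂μ) M.hα M.hT_nonneg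
    M.hT_rowsum M.hT_first M.hQ_irred M.hr_pos
    (fun n k => integral_nonneg fun ω => (M.hX_mem n ω k).1) (fun k => ?_)
    (integral_eq_zero_of_ae (M.hX_stub 0)) M.integral_X_succ k
  simpa using integral_mono (M.integrable_X 0 k) (integrable_const 1) fun ω => (M.hX_mem 0 ω k).2

end RAStubbornModel

/-- **Herding at the stubborn agent's opinion (Proposition 2).**
In the RA model with a stubborn agent, for every agent `k` and every `ε > 0`,
`P(X_k[n] > ε) → 0` as `n → ∞`; that is, every opinion converges in probability to the
stubborn agent's constant opinion `0`. -/
theorem RA_stubborn_herding {m : ℕ} (hm : 1 ≤ m) {Ω : Type*} [MeasurableSpace Ω]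
    {μ : Measure Ω} [IsProbabilityMeasure μ] (M : RAStubbornModel m Ω μ) :
    ∀ k : Fin (m + 1), ∀ ε : ℝ, 0 < ε →
      Tendsto (fun n => μ {ω | ε < M.X n ω k}) atTop (nhds 0) := by
  intro k ε hε
  have hlim : Tendsto (fun n => ENNReal.ofReal ((∫ ω, M.X n ω k ∂μ) / ε)) atTop (nhds 0) := by
    simpa using ENNReal.tendsto_ofReal ((M.tendsto_integral_X k).div_const ε)
  refine tendsto_of_tendsto_of_tendsto_of_le_of_le tendsto_const_nhds hlim
    (fun _ => zero_le) fun n => ?_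
  have hmarkov := mul_meas_ge_le_integral_of_nonneg
    (.of_forall fun ω => (M.hX_mem n ω k).1) (M.integrable_X n k) ε
  refine (measure_mono fun ω (hω : ε < M.X n ω k) => hω.le).trans
    ((ENNReal.le_ofReal_iff_toReal_le (measure_ne_top _ _)
      (div_nonneg (integral_nonneg fun ω => (M.hX_mem n ω k).1) hε.le)).2 ?_)
  rw [le_div_iff₀' hε]
  exact hmarkov
end

section
/- In the RA model with a stubborn agent, with λ ∈ (0,1) the spectral radius of Q and ψ a positive left eigenvector of Q for λ, the process S[n] = ψᵀY[n] satisfies E[S[n+1] | F_n] = (1 − α(1−λ)) S[n] almost surely; in particular, on the event S[n] > 0 we have E[S[n+1] | F_n] < S[n], so S[n] is a nonnegative supermartingale. -/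
open MeasureTheory Filter

namespace RAStubbornModel

variable {m : ℕ} {Ω : Type*} [mΩ : MeasurableSpace Ω] {μ : Measure Ω}

theorem integrable_opinion [IsFiniteMeasure μ] (M : RAStubbornModel m Ω μ) (n : ℕ)
    (k : Fin (m + 1)) : Integrable (fun ω => M.X n ω k) μ := by
  have hmeas : Measurable fun ω => M.X n ω k :=
    (measurable_pi_apply k).comp ((M.hX_adapted n).mono (M.ℱ.le n) le_rfl)
  refine Integrable.of_bound hmeas.aestronglyMeasurable 1 (ae_of_all _ fun ω => ?_)
  rw [Real.norm_of_nonneg (M.hX_mem n ω k).1]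
  exact (M.hX_mem n ω k).2

theorem integrable_action [IsFiniteMeasure μ] (M : RAStubbornModel m Ω μ) (n : ℕ)
    (k : Fin (m + 1)) : Integrable (fun ω => M.A n ω k) μ := by
  have hmeas : Measurable fun ω => M.A n ω k :=
    (measurable_pi_apply k).comp ((M.hA_meas n).mono (M.ℱ.le (n + 1)) le_rfl)
  refine Integrable.of_bound hmeas.aestronglyMeasurable 1 (ae_of_all _ fun ω => ?_)
  rcases M.hA_val n ω k with h | h <;> simp [h]

theorem condExp_action (M : RAStubbornModel m Ω μ) (n : ℕ) (k : Fin (m + 1)) :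
    μ[fun ω => M.A n ω k | M.ℱ n] =ᵐ[μ] fun ω => M.X n ω k := by
  simpa using M.hA_cond n {k}

/-- The total opinion of the non-stubborn agents, weighted by `ψ`. -/
def weightedOpinion (M : RAStubbornModel m Ω μ) (ψ : Fin m → ℝ) (n : ℕ) (ω : Ω) : ℝ :=
  ∑ i : Fin m, ψ i * M.X n ω i.succ

theorem stronglyMeasurable_weightedOpinion (M : RAStubbornModel m Ω μ) (ψ : Fin m → ℝ) (n : ℕ) :
    StronglyMeasurable[M.ℱ n] (M.weightedOpinion ψ n) := by
  refine Measurable.stronglyMeasurable (Finset.measurable_sum _ fun i _ => ?_)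
  exact ((measurable_pi_apply i.succ).comp (M.hX_adapted n)).const_mul (ψ i)

theorem integrable_weightedOpinion [IsFiniteMeasure μ] (M : RAStubbornModel m Ω μ)
    (ψ : Fin m → ℝ) (n : ℕ) : Integrable (M.weightedOpinion ψ n) μ :=
  integrable_finsetSum _ fun i _ => (M.integrable_opinion n i.succ).const_mul (ψ i)

theorem weightedOpinion_nonneg (M : RAStubbornModel m Ω μ) {ψ : Fin m → ℝ} (hψ : ∀ i, 0 ≤ ψ i)
    (n : ℕ) (ω : Ω) : 0 ≤ M.weightedOpinion ψ n ω :=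
  Finset.sum_nonneg fun i _ => mul_nonneg (hψ i) (M.hX_mem n ω i.succ).1

/-- One step of the weighted opinion when the weights form a left eigenvector of the trust
matrix restricted to the non-stubborn agents. -/
theorem weightedOpinion_succ (M : RAStubbornModel m Ω μ) {ψ : Fin m → ℝ} {lam : ℝ}
    (hψ : ∀ j, ∑ i, ψ i * M.T i.succ j.succ = lam * ψ j) (n : ℕ) :
    M.weightedOpinion ψ (n + 1) =ᵐ[μ] (1 - M.α) • M.weightedOpinion ψ n +
      (M.α * lam) • ∑ j : Fin m, ψ j • fun ω => M.A n ω j.succ := by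
  filter_upwards [M.hA_stub n] with ω hω
  have hswap : ∑ i : Fin m, ψ i * ∑ j : Fin m, M.T i.succ j.succ * M.A n ω j.succ =
      lam * ∑ j : Fin m, ψ j * M.A n ω j.succ := by
    simp_rw [Finset.mul_sum]
    rw [Finset.sum_comm]
    refine Finset.sum_congr rfl fun j _ => ?_
    rw [← mul_assoc, ← hψ j, Finset.sum_mul]
    exact Finset.sum_congr rfl fun i _ => by ring
  have hstep : ∀ i : Fin m, ψ i * M.X (n + 1) ω i.succ = (1 - M.α) * (ψ i * M.X n ω i.succ) +
      M.α * (ψ i * ∑ j : Fin m, M.T i.succ j.succ * M.A n ω j.succ) := fun i => by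
    rw [M.h_update, Fin.sum_univ_succ, hω]
    ring
  simp only [weightedOpinion, Pi.add_apply, Pi.smul_apply, Finset.sum_apply, smul_eq_mul]
  rw [Finset.sum_congr rfl fun i _ => hstep i, Finset.sum_add_distrib, ← Finset.mul_sum,
    ← Finset.mul_sum, hswap, mul_assoc]

theorem condExp_weightedOpinion_succ [IsFiniteMeasure μ] (M : RAStubbornModel m Ω μ)
    {ψ : Fin m → ℝ} {lam : ℝ} (hψ : ∀ j, ∑ i, ψ i * M.T i.succ j.succ = lam * ψ j) (n : ℕ) :
    μ[M.weightedOpinion ψ (n + 1) | M.ℱ n] =ᵐ[μ]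
      fun ω => (1 - M.α * (1 - lam)) * M.weightedOpinion ψ n ω := by
  have hA : ∀ j : Fin m, Integrable (ψ j • fun ω => M.A n ω j.succ) μ := fun j =>
    (M.integrable_action n j.succ).smul (ψ j)
  have hsum : μ[∑ j : Fin m, ψ j • fun ω => M.A n ω j.succ | M.ℱ n] =ᵐ[μ]
      M.weightedOpinion ψ n := by
    have hterm : ∀ᵐ ω ∂μ, ∀ j : Fin m,
        (μ[ψ j • fun ω => M.A n ω j.succ | M.ℱ n]) ω = ψ j * M.X n ω j.succ := by
      refine ae_all_iff.2 fun j => ?_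
      filter_upwards [condExp_smul (μ := μ) (ψ j) (fun ω => M.A n ω j.succ) (M.ℱ n),
        M.condExp_action n j.succ] with ω h₁ h₂
      rw [h₁, Pi.smul_apply, h₂, smul_eq_mul]
    filter_upwards [condExp_finsetSum (fun j (_ : j ∈ Finset.univ) => hA j) (M.ℱ n),
      hterm] with ω h₁ h₂
    rw [h₁, Finset.sum_apply]
    exact Finset.sum_congr rfl fun j _ => h₂ j
  have hS := M.integrable_weightedOpinion ψ n
  have hadd := condExp_add (hS.smul (1 - M.α))
    ((integrable_finsetSum' Finset.univ fun j _ => hA j).smul (M.α * lam)) (M.ℱ n)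
  filter_upwards [condExp_congr_ae (m := M.ℱ n) (M.weightedOpinion_succ hψ n), hadd, hsum,
    condExp_smul (μ := μ) (1 - M.α) (M.weightedOpinion ψ n) (M.ℱ n),
    condExp_smul (μ := μ) (M.α * lam) (∑ j : Fin m, ψ j • fun ω => M.A n ω j.succ) (M.ℱ n)]
    with ω h₁ h₂ h₃ h₄ h₅
  rw [h₁, h₂, Pi.add_apply, h₄, h₅, Pi.smul_apply, Pi.smul_apply, h₃,
    condExp_of_stronglyMeasurable (M.ℱ.le n) (M.stronglyMeasurable_weightedOpinion ψ n) hS,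
    smul_eq_mul, smul_eq_mul]
  ring

end RAStubbornModel

/-- **`S[n] = ψᵀ Y[n]` is a strict nonnegative supermartingale.**
In the RA model with a stubborn agent, let `lam ∈ (0,1)` be the spectral radius of `Q` and `ψ` a
positive left eigenvector of `Q` for `lam` normalized to sum `1`.  Then
`S[n] = ψᵀ Y[n] = ∑ i, ψ i · X_{i+1}[n]` satisfies
`E[S[n+1] | ℱ n] = (1 - α (1 - lam)) S[n]` a.s.; in particular `S` is nonnegative, on the event
`S[n] > 0` we have `E[S[n+1] | ℱ n] < S[n]`, and `S` is a supermartingale. -/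
theorem RA_stubborn_supermartingale {m : ℕ} (hm : 1 ≤ m) {Ω : Type*} [MeasurableSpace Ω]
    {μ : Measure Ω} [IsProbabilityMeasure μ] (M : RAStubbornModel m Ω μ)
    (lam : ℝ) (hlam : lam ∈ Set.Ioo (0 : ℝ) 1)
    (hlam_spec : spectralRadius ℂ
        ((Matrix.of fun (a b : Fin m) => M.T a.succ b.succ).map (Complex.ofReal ·))
      = ENNReal.ofReal lam)
    (ψ : Fin m → ℝ) (hψ_pos : ∀ i, 0 < ψ i) (hψ_sum : ∑ i, ψ i = 1)
    (hψ_eig : ∀ j, ∑ i, ψ i * M.T i.succ j.succ = lam * ψ j)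
    (S : ℕ → Ω → ℝ) (hS : ∀ n ω, S n ω = ∑ i : Fin m, ψ i * M.X n ω i.succ) :
    (∀ n, μ[S (n + 1) | M.ℱ n] =ᵐ[μ] fun ω => (1 - M.α * (1 - lam)) * S n ω) ∧
    (∀ n ω, 0 ≤ S n ω) ∧
    (∀ n, ∀ᵐ ω ∂μ, 0 < S n ω → (μ[S (n + 1) | M.ℱ n]) ω < S n ω) ∧
    Supermartingale S M.ℱ μ := by
  obtain rfl : S = M.weightedOpinion ψ := funext fun n => funext fun ω => hS n ω
  have hcond := M.condExp_weightedOpinion_succ hψ_eig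
  have hnonneg := M.weightedOpinion_nonneg fun i => (hψ_pos i).le
  have hrate : 0 < M.α * (1 - lam) := mul_pos M.hα.1 (sub_pos.2 hlam.2)
  refine ⟨hcond, hnonneg, fun n => ?_, supermartingale_nat
    (M.stronglyMeasurable_weightedOpinion ψ) (M.integrable_weightedOpinion ψ) fun n => ?_⟩
  · filter_upwards [hcond n] with ω hω hpos
    rw [hω]
    nlinarith [mul_pos hrate hpos]
  · filter_upwards [hcond n] with ω hω
    rw [hω]
    nlinarith [mul_nonneg hrate.le (hnonneg n ω)]
end

section
/- In the RA model with a stubborn agent, the conditional variance of the increments of S[n] = ψᵀY[n] converges to zero in mean square: E[(Var(ΔS[n+1] | F_n))²] → 0 as n → ∞, where ΔS[n+1] = S[n+1] − S[n]. -/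
open MeasureTheory Filter

/-- Actions and opinions have the same mean. -/
lemma RAStubbornModel.integral_action {m : ℕ} {Ω : Type*} [MeasurableSpace Ω] {μ : Measure Ω}
    [IsProbabilityMeasure μ] (M : RAStubbornModel m Ω μ) (n : ℕ) (k : Fin (m + 1)) :
    ∫ ω, M.A n ω k ∂μ = ∫ ω, M.X n ω k ∂μ := by
  have h := M.hA_cond n {k}
  simp only [Finset.prod_singleton] at h
  rw [← integral_condExp (M.ℱ.le n), integral_congr_ae h]

lemma RAStubbornModel.integrable_opinion_s13 {m : ℕ} {Ω : Type*} [MeasurableSpace Ω] {μ : Measure Ω}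
    [IsProbabilityMeasure μ] (M : RAStubbornModel m Ω μ) (n : ℕ) (k : Fin (m + 1)) :
    Integrable (fun ω => M.X n ω k) μ := by
  have hmeas : Measurable (M.X n) := (M.hX_adapted n).mono (M.ℱ.le n) le_rfl
  refine Integrable.of_bound ((measurable_pi_apply k).comp hmeas).aestronglyMeasurable 1
    (ae_of_all _ fun ω => ?_)
  obtain ⟨h0, h1⟩ := M.hX_mem n ω k
  rw [Real.norm_eq_abs, abs_of_nonneg h0]
  exact h1

lemma RAStubbornModel.integrable_action_s13 {m : ℕ} {Ω : Type*} [MeasurableSpace Ω] {μ : Measure Ω}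
    [IsProbabilityMeasure μ] (M : RAStubbornModel m Ω μ) (n : ℕ) (k : Fin (m + 1)) :
    Integrable (fun ω => M.A n ω k) μ := by
  have hmeas : Measurable (M.A n) := (M.hA_meas n).mono (M.ℱ.le (n + 1)) le_rfl
  refine Integrable.of_bound ((measurable_pi_apply k).comp hmeas).aestronglyMeasurable 1
    (ae_of_all _ fun ω => ?_)
  rcases M.hA_val n ω k with h | h <;> simp [h]

/-- The mean opinion, weighted by a left eigenvector of `Q`, obeys a linear recursion. -/
lemma RAStubbornModel.integral_weighted_succ {m : ℕ} {Ω : Type*} [MeasurableSpace Ω]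
    {μ : Measure Ω} [IsProbabilityMeasure μ] (M : RAStubbornModel m Ω μ) {lam : ℝ}
    {ψ : Fin m → ℝ} (hψ_eig : ∀ j, ∑ i, ψ i * M.T i.succ j.succ = lam * ψ j) (n : ℕ) :
    ∫ ω, ∑ i, ψ i * M.X (n + 1) ω i.succ ∂μ
      = ((1 - M.α) + M.α * lam) * ∫ ω, ∑ i, ψ i * M.X n ω i.succ ∂μ := by
  have hmean (n : ℕ) : ∫ ω, ∑ i, ψ i * M.X n ω i.succ ∂μ
      = ∑ i, ψ i * ∫ ω, M.X n ω i.succ ∂μ := by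
    rw [integral_finsetSum _ fun i _ => (M.integrable_opinion_s13 n i.succ).const_mul _]
    simp only [integral_const_mul]
  have hstep (k : Fin (m + 1)) : ∫ ω, M.X (n + 1) ω k ∂μ
      = (1 - M.α) * ∫ ω, M.X n ω k ∂μ + M.α * ∑ j : Fin m, M.T k j.succ *
        ∫ ω, M.X n ω j.succ ∂μ := by
    have hzero : ∫ ω, M.X n ω 0 ∂μ = 0 := by
      rw [integral_congr_ae (M.hX_stub n), integral_zero]
    simp only [M.h_update]
    rw [integral_add ((M.integrable_opinion_s13 n k).const_mul _)
      ((integrable_finsetSum _ fun j _ => (M.integrable_action_s13 n j).const_mul _).const_mul _),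
      integral_const_mul, integral_const_mul,
      integral_finsetSum _ fun j _ => (M.integrable_action_s13 n j).const_mul _]
    simp only [integral_const_mul, M.integral_action]
    rw [Fin.sum_univ_succ, hzero, mul_zero, zero_add]
  have hswap : ∑ i, ψ i * ∑ j : Fin m, M.T i.succ j.succ * ∫ ω, M.X n ω j.succ ∂μ
      = lam * ∑ j, ψ j * ∫ ω, M.X n ω j.succ ∂μ := by
    simp only [Finset.mul_sum]
    rw [Finset.sum_comm]
    refine Finset.sum_congr rfl fun j _ => ?_
    simp only [← mul_assoc]
    rw [← Finset.sum_mul, hψ_eig]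
  rw [hmean, hmean, add_mul, mul_assoc M.α, ← hswap, Finset.mul_sum, Finset.mul_sum,
    ← Finset.sum_add_distrib]
  refine Finset.sum_congr rfl fun i _ => ?_
  rw [hstep]
  ring

/-- For `[0,1]`-valued variables, the second moment of the conditional variance of a difference is
at most the sum of the means. -/
lemma integral_condVar_sub_sq_le {Ω : Type*} {m mΩ : MeasurableSpace Ω} {μ : Measure Ω}
    [IsProbabilityMeasure μ] (hm : m ≤ mΩ) {f g : Ω → ℝ} (hf : Integrable f μ)
    (hg : Integrable g μ) (hf_mem : ∀ ω, f ω ∈ Set.Icc (0 : ℝ) 1)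
    (hg_mem : ∀ ω, g ω ∈ Set.Icc (0 : ℝ) 1) :
    ∫ ω, ((μ[fun ω' => (f ω' - g ω') ^ 2 | m]) ω - ((μ[fun ω' => f ω' - g ω' | m]) ω) ^ 2) ^ 2 ∂μ
      ≤ ∫ ω, f ω ∂μ + ∫ ω, g ω ∂μ := by
  have hsub : Integrable (fun ω => f ω - g ω) μ := hf.sub hg
  have hadd : Integrable (fun ω => f ω + g ω) μ := hf.add hg
  have hsq : Integrable (fun ω => (f ω - g ω) ^ 2) μ := by
    refine Integrable.of_bound (hsub.aestronglyMeasurable.pow 2) 1 (ae_of_all _ fun ω => ?_)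
    obtain ⟨⟨_, _⟩, ⟨_, _⟩⟩ := And.intro (hf_mem ω) (hg_mem ω)
    rw [Real.norm_eq_abs, abs_of_nonneg (sq_nonneg _)]
    nlinarith
  have hsq_nonneg : 0 ≤ᵐ[μ] μ[fun ω' => (f ω' - g ω') ^ 2 | m] :=
    condExp_nonneg (ae_of_all _ fun ω => sq_nonneg _)
  have hone : μ[fun _ => (1 : ℝ) | m] = fun _ => 1 := condExp_const hm 1
  have hsq_le_one : μ[fun ω' => (f ω' - g ω') ^ 2 | m] ≤ᵐ[μ] μ[fun _ => (1 : ℝ) | m] := by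
    refine condExp_mono hsq (integrable_const _) (ae_of_all _ fun ω => ?_)
    obtain ⟨⟨_, _⟩, ⟨_, _⟩⟩ := And.intro (hf_mem ω) (hg_mem ω)
    change (f ω - g ω) ^ 2 ≤ 1
    nlinarith
  have hsub_le_one : μ[fun ω' => f ω' - g ω' | m] ≤ᵐ[μ] μ[fun _ => (1 : ℝ) | m] := by
    refine condExp_mono hsub (integrable_const _) (ae_of_all _ fun ω => ?_)
    change f ω - g ω ≤ 1
    linarith [(hf_mem ω).2, (hg_mem ω).1]
  have hneg_one : μ[fun _ => (-1 : ℝ) | m] = fun _ => -1 := condExp_const hm (-1)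
  have hneg_one_le_sub : μ[fun _ => (-1 : ℝ) | m] ≤ᵐ[μ] μ[fun ω' => f ω' - g ω' | m] := by
    refine condExp_mono (integrable_const _) hsub (ae_of_all _ fun ω => ?_)
    change -1 ≤ f ω - g ω
    linarith [(hf_mem ω).1, (hg_mem ω).2]
  have hsq_le_add : μ[fun ω' => (f ω' - g ω') ^ 2 | m] ≤ᵐ[μ] μ[fun ω' => f ω' + g ω' | m] := by
    refine condExp_mono hsq hadd (ae_of_all _ fun ω => ?_)
    obtain ⟨⟨_, _⟩, ⟨_, _⟩⟩ := And.intro (hf_mem ω) (hg_mem ω)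
    change (f ω - g ω) ^ 2 ≤ f ω + g ω
    nlinarith
  have hsub_le_add : μ[fun ω' => f ω' - g ω' | m] ≤ᵐ[μ] μ[fun ω' => f ω' + g ω' | m] := by
    refine condExp_mono hsub hadd (ae_of_all _ fun ω => ?_)
    change f ω - g ω ≤ f ω + g ω
    linarith [(hg_mem ω).1]
  have hneg_sub_le_add :
      μ[-(fun ω' => f ω' - g ω') | m] ≤ᵐ[μ] μ[fun ω' => f ω' + g ω' | m] := by
    refine condExp_mono hsub.neg hadd (ae_of_all _ fun ω => ?_)
    change -(f ω - g ω) ≤ f ω + g ω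
    linarith [(hf_mem ω).1]
  rw [← integral_add hf hg, ← integral_condExp hm (f := fun ω => f ω + g ω)]
  refine integral_mono_of_nonneg (ae_of_all _ fun ω => sq_nonneg _) integrable_condExp ?_
  rw [hone] at hsq_le_one hsub_le_one
  rw [hneg_one] at hneg_one_le_sub
  filter_upwards [hsq_nonneg, hsq_le_one, hsub_le_one, hneg_one_le_sub, hsq_le_add, hsub_le_add,
    hneg_sub_le_add, condExp_neg (μ := μ) (fun ω' => f ω' - g ω') m]
    with ω h1 h2 h3 h4 h5 h6 h7 h8
  rw [h8, Pi.neg_apply] at h7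
  simp only [Pi.zero_apply] at h1
  set a := (μ[fun ω' => (f ω' - g ω') ^ 2 | m]) ω
  set c := (μ[fun ω' => f ω' - g ω' | m]) ω
  set d := (μ[fun ω' => f ω' + g ω' | m]) ω
  have hc1 : |c| ≤ 1 := abs_le.2 ⟨h4, h3⟩
  have hcd : |c| ≤ d := abs_le.2 ⟨by linarith, h6⟩
  have hc2 : c ^ 2 ≤ |c| := by
    rw [← sq_abs]
    nlinarith [abs_nonneg c]
  have hV : |a - c ^ 2| ≤ min 1 d := abs_le.2
    ⟨by linarith [le_min (hc2.trans hc1) (hc2.trans hcd)],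
      by linarith [le_min h2 h5, sq_nonneg c]⟩
  calc (a - c ^ 2) ^ 2 = |a - c ^ 2| ^ 2 := (sq_abs _).symm
    _ ≤ |a - c ^ 2| := by
      nlinarith [abs_nonneg (a - c ^ 2), hV.trans (min_le_left _ _)]
    _ ≤ d := hV.trans (min_le_right _ _)

/-- **Mean-square convergence of the conditional variance of the increments of `S[n]`.**
In the RA model with a stubborn agent, with `lam ∈ (0,1)` the spectral radius of `Q` and `ψ` a
positive left eigenvector of `Q` for `lam` normalized to sum `1`, the conditional variance
`Var(ΔS[n+1] | ℱ n) = E[(ΔS[n+1])² | ℱ n] - (E[ΔS[n+1] | ℱ n])²` of the increments of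
`S[n] = ψᵀ Y[n]` converges to `0` in mean square: `E[(Var(ΔS[n+1] | ℱ n))²] → 0`. -/
theorem RA_stubborn_cond_variance_ms_convergence {m : ℕ} (hm : 1 ≤ m) {Ω : Type*}
    [MeasurableSpace Ω]
    {μ : Measure Ω} [IsProbabilityMeasure μ] (M : RAStubbornModel m Ω μ)
    (lam : ℝ) (hlam : lam ∈ Set.Ioo (0 : ℝ) 1)
    (hlam_spec : spectralRadius ℂ
        ((Matrix.of fun (a b : Fin m) => M.T a.succ b.succ).map (Complex.ofReal ·))
      = ENNReal.ofReal lam)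
    (ψ : Fin m → ℝ) (hψ_pos : ∀ i, 0 < ψ i) (hψ_sum : ∑ i, ψ i = 1)
    (hψ_eig : ∀ j, ∑ i, ψ i * M.T i.succ j.succ = lam * ψ j)
    (S : ℕ → Ω → ℝ) (hS : ∀ n ω, S n ω = ∑ i : Fin m, ψ i * M.X n ω i.succ) :
    Tendsto (fun n => ∫ ω, ((μ[fun ω' => (S (n + 1) ω' - S n ω') ^ 2 | M.ℱ n]) ω
        - ((μ[fun ω' => S (n + 1) ω' - S n ω' | M.ℱ n]) ω) ^ 2) ^ 2 ∂μ)
      atTop (nhds 0) := by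
  obtain ⟨hα0, hα1⟩ := M.hα
  obtain ⟨hlam0, hlam1⟩ := hlam
  obtain rfl : S = fun n ω => ∑ i : Fin m, ψ i * M.X n ω i.succ := by
    funext n ω
    exact hS n ω
  have hint (n : ℕ) : Integrable (fun ω => ∑ i : Fin m, ψ i * M.X n ω i.succ) μ :=
    integrable_finsetSum _ fun i _ => (M.integrable_opinion_s13 n i.succ).const_mul _
  have hmem (n : ℕ) (ω : Ω) : ∑ i : Fin m, ψ i * M.X n ω i.succ ∈ Set.Icc (0 : ℝ) 1 := by
    refine ⟨Finset.sum_nonneg fun i _ => mul_nonneg (hψ_pos i).le (M.hX_mem n ω _).1, ?_⟩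
    rw [← hψ_sum]
    exact Finset.sum_le_sum fun i _ => mul_le_of_le_one_right (hψ_pos i).le (M.hX_mem n ω _).2
  have hgeom (n : ℕ) : ∫ ω, ∑ i, ψ i * M.X n ω i.succ ∂μ
      = ((1 - M.α) + M.α * lam) ^ n * ∫ ω, ∑ i, ψ i * M.X 0 ω i.succ ∂μ := by
    induction n with
    | zero => simp
    | succ n ih => rw [M.integral_weighted_succ hψ_eig, ih, pow_succ']; ring
  have hlim : Tendsto (fun n => ∫ ω, ∑ i, ψ i * M.X n ω i.succ ∂μ) atTop (nhds 0) := by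
    rw [funext hgeom]
    simpa using (tendsto_pow_atTop_nhds_zero_of_lt_one
      (r := (1 - M.α) + M.α * lam) (by nlinarith) (by nlinarith)).mul_const _
  have hbound := ((tendsto_add_atTop_iff_nat 1).2 hlim).add hlim
  rw [add_zero] at hbound
  exact squeeze_zero (fun n => integral_nonneg fun ω => sq_nonneg _)
    (fun n => integral_condVar_sub_sq_le (M.ℱ.le n) (hint (n + 1)) (hint n) (hmem (n + 1)) (hmem n))
    hbound
end

section
/- In the RA model, the conditional variance of the martingale difference ΔQ[n] = Q[n] − Q[n−1] of Q[n] = πᵀX[n] satisfies, almost surely, Var(ΔQ[n] | F_{n−1}) = E[(ΔQ[n])² | F_{n−1}] = α² Σ_{k=1}^{K} π_k² X_k[n−1](1 − X_k[n−1]). -/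
open MeasureTheory Filter

namespace RAModel

variable {K : ℕ} {Ω : Type*} [mΩ : MeasurableSpace Ω] {μ : Measure Ω} (M : RAModel K Ω μ)

lemma measurable_action (n : ℕ) (k : Fin K) : Measurable fun ω => M.A n ω k :=
  (measurable_pi_apply k).comp ((M.hA_meas n).mono (M.ℱ.le (n + 1)) le_rfl)

lemma stronglyMeasurable_opinion (n : ℕ) (k : Fin K) :
    StronglyMeasurable[M.ℱ n] fun ω => M.X n ω k :=
  ((measurable_pi_apply k).comp (M.hX_adapted n)).stronglyMeasurable

lemma memLp_action [IsFiniteMeasure μ] (n : ℕ) (k : Fin K) (p : ENNReal) :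
    MemLp (fun ω => M.A n ω k) p μ := by
  refine MemLp.of_bound (M.measurable_action n k).aestronglyMeasurable 1 (ae_of_all _ fun ω => ?_)
  rcases M.hA_val n ω k with h | h <;> simp [h]

lemma memLp_opinion [IsFiniteMeasure μ] (n : ℕ) (k : Fin K) (p : ENNReal) :
    MemLp (fun ω => M.X n ω k) p μ := by
  refine MemLp.of_bound
    ((M.stronglyMeasurable_opinion n k).mono (M.ℱ.le n)).aestronglyMeasurable 1
    (ae_of_all _ fun ω => ?_)
  rw [Real.norm_of_nonneg (M.hX_mem n ω k).1]
  exact (M.hX_mem n ω k).2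

/-- The conditional mean of an action is the opinion. -/
lemma condExp_action (n : ℕ) (k : Fin K) :
    μ[fun ω => M.A n ω k | M.ℱ n] =ᵐ[μ] fun ω => M.X n ω k := by
  simpa using M.hA_cond n {k}

lemma condExp_action_mul_action (n : ℕ) (j k : Fin K) :
    μ[fun ω => M.A n ω j * M.A n ω k | M.ℱ n]
      =ᵐ[μ] fun ω => if j = k then M.X n ω k else M.X n ω j * M.X n ω k := by
  by_cases h : j = k
  · subst h
    have h_idem : (fun ω => M.A n ω j * M.A n ω j) = fun ω => M.A n ω j := by
      ext ω
      rcases M.hA_val n ω j with h | h <;> simp [h]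
    simpa [h_idem] using M.condExp_action n j
  · simpa [h, Finset.prod_pair h] using M.hA_cond n {j, k}

/-- The deviation of the action of agent `k` from its conditional mean. -/
def noise (n : ℕ) (k : Fin K) (ω : Ω) : ℝ := M.A n ω k - M.X n ω k

lemma memLp_noise [IsFiniteMeasure μ] (n : ℕ) (k : Fin K) (p : ENNReal) :
    MemLp (M.noise n k) p μ :=
  (M.memLp_action n k p).sub (M.memLp_opinion n k p)

lemma condExp_noise [IsFiniteMeasure μ] (n : ℕ) (k : Fin K) :
    μ[M.noise n k | M.ℱ n] =ᵐ[μ] 0 := by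
  have h_sub := condExp_sub ((M.memLp_action n k 1).integrable le_rfl)
    ((M.memLp_opinion n k 1).integrable le_rfl) (M.ℱ n)
  rw [condExp_of_stronglyMeasurable (M.ℱ.le n) (M.stronglyMeasurable_opinion n k)
    ((M.memLp_opinion n k 1).integrable le_rfl)] at h_sub
  filter_upwards [h_sub, M.condExp_action n k] with ω h₁ h₂
  change (μ[(fun ω => M.A n ω k) - fun ω => M.X n ω k | M.ℱ n]) ω = 0
  simp [h₁, h₂]

/-- The conditional covariance matrix of the noise is diagonal, with Bernoulli variances. -/
lemma condExp_noise_mul_noise [IsFiniteMeasure μ] (n : ℕ) (j k : Fin K) :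
    μ[fun ω => M.noise n j ω * M.noise n k ω | M.ℱ n]
      =ᵐ[μ] fun ω => if j = k then M.X n ω k * (1 - M.X n ω k) else 0 := by
  have h_split : (fun ω => M.noise n j ω * M.noise n k ω)
      = (fun ω => M.A n ω j * M.A n ω k) - (fun ω => M.X n ω k * M.A n ω j)
        - (fun ω => M.X n ω j * M.noise n k ω) := by
    ext ω
    simp only [noise, Pi.sub_apply]
    ring
  have h_int_AA : Integrable (fun ω => M.A n ω j * M.A n ω k) μ :=
    (M.memLp_action n j 2).integrable_mul (M.memLp_action n k 2)
  have h_int_XA : Integrable (fun ω => M.X n ω k * M.A n ω j) μ :=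
    (M.memLp_opinion n k 2).integrable_mul (M.memLp_action n j 2)
  have h_int_XN : Integrable (fun ω => M.X n ω j * M.noise n k ω) μ :=
    (M.memLp_opinion n j 2).integrable_mul (M.memLp_noise n k 2)
  have h_pull_A := condExp_mul_of_stronglyMeasurable_left (M.stronglyMeasurable_opinion n k)
    h_int_XA ((M.memLp_action n j 1).integrable le_rfl)
  have h_pull_N := condExp_mul_of_stronglyMeasurable_left (M.stronglyMeasurable_opinion n j)
    h_int_XN ((M.memLp_noise n k 1).integrable le_rfl)
  rw [h_split]
  filter_upwards [condExp_sub (h_int_AA.sub h_int_XA) h_int_XN (M.ℱ n),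
    condExp_sub h_int_AA h_int_XA (M.ℱ n), h_pull_A, h_pull_N,
    M.condExp_action_mul_action n j k, M.condExp_action n j, M.condExp_noise n k]
    with ω h₁ h₂ h₃ h₄ h₅ h₆ h₇
  simp only [Pi.sub_apply, Pi.mul_apply, Pi.zero_apply, Pi.mul_def] at h₁ h₂ h₃ h₄ h₇
  rw [h₁, h₂, h₃, h₄, h₅, h₆, h₇]
  split_ifs with h
  · subst h
    ring
  · ring

lemma condExp_sum_noise [IsFiniteMeasure μ] (n : ℕ) (c : Fin K → ℝ) :
    μ[fun ω => ∑ k, c k * M.noise n k ω | M.ℱ n] =ᵐ[μ] 0 := by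
  have h_sum := condExp_finsetSum (s := Finset.univ) (f := fun k => c k • M.noise n k)
    (fun k _ => ((M.memLp_noise n k 1).integrable le_rfl).smul (c k)) (M.ℱ n)
  have h_eq : (fun ω => ∑ k, c k * M.noise n k ω) = ∑ k, c k • M.noise n k := by
    ext ω
    simp
  rw [h_eq]
  filter_upwards [h_sum, ae_all_iff.2 fun k => condExp_smul (μ := μ) (c k) (M.noise n k) (M.ℱ n),
    ae_all_iff.2 fun k => M.condExp_noise n k] with ω h₁ h₂ h₃
  rw [h₁]
  simp [Finset.sum_apply, h₂, h₃]

lemma condExp_sum_noise_sq [IsFiniteMeasure μ] (n : ℕ) (c : Fin K → ℝ) :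
    μ[fun ω => (∑ k, c k * M.noise n k ω) ^ 2 | M.ℱ n]
      =ᵐ[μ] fun ω => ∑ k, c k ^ 2 * (M.X n ω k * (1 - M.X n ω k)) := by
  have h_sum := condExp_finsetSum (s := Finset.univ)
    (f := fun p : Fin K × Fin K => (c p.1 * c p.2) • fun ω => M.noise n p.1 ω * M.noise n p.2 ω)
    (fun p _ => ((M.memLp_noise n p.1 2).integrable_mul (M.memLp_noise n p.2 2)).smul
      (c p.1 * c p.2)) (M.ℱ n)
  have h_eq : (fun ω => (∑ k, c k * M.noise n k ω) ^ 2)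
      = ∑ p : Fin K × Fin K, (c p.1 * c p.2) • fun ω => M.noise n p.1 ω * M.noise n p.2 ω := by
    ext ω
    simp only [sq, Finset.sum_mul_sum, Finset.sum_apply, Pi.smul_apply, smul_eq_mul,
      Fintype.sum_prod_type]
    exact Finset.sum_congr rfl fun i _ => Finset.sum_congr rfl fun j _ => by ring
  rw [h_eq]
  filter_upwards [h_sum,
    ae_all_iff.2 fun p : Fin K × Fin K => condExp_smul (μ := μ) (c p.1 * c p.2)
      (fun ω => M.noise n p.1 ω * M.noise n p.2 ω) (M.ℱ n),
    ae_all_iff.2 fun p : Fin K × Fin K => M.condExp_noise_mul_noise n p.1 p.2] with ω h₁ h₂ h₃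
  rw [h₁]
  simp [Finset.sum_apply, h₂, h₃, Fintype.sum_prod_type, sq]

/-- The increment of the weighted opinion `πᵀ X` is a linear combination of the noise. -/
lemma sum_opinion_succ_sub (π : Fin K → ℝ) (hπ : ∀ j, ∑ i, π i * M.T i j = π j)
    (n : ℕ) (ω : Ω) :
    ∑ k, π k * M.X (n + 1) ω k - ∑ k, π k * M.X n ω k
      = ∑ k, M.α * π k * M.noise n k ω := by
  have h_swap : ∑ k, π k * ∑ j, M.T k j * M.A n ω j = ∑ j, π j * M.A n ω j := by
    simp_rw [Finset.mul_sum]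
    rw [Finset.sum_comm]
    refine Finset.sum_congr rfl fun j _ => ?_
    rw [← hπ j, Finset.sum_mul]
    exact Finset.sum_congr rfl fun i _ => by ring
  calc ∑ k, π k * M.X (n + 1) ω k - ∑ k, π k * M.X n ω k
      = M.α * ∑ k, π k * ∑ j, M.T k j * M.A n ω j - M.α * ∑ k, π k * M.X n ω k := by
        simp_rw [M.h_update]
        rw [Finset.mul_sum, Finset.mul_sum, ← Finset.sum_sub_distrib, ← Finset.sum_sub_distrib]
        exact Finset.sum_congr rfl fun k _ => by ring
    _ = ∑ k, M.α * π k * M.noise n k ω := by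
        rw [h_swap, Finset.mul_sum, Finset.mul_sum, ← Finset.sum_sub_distrib]
        exact Finset.sum_congr rfl fun k _ => by simp only [noise]; ring

end RAModel

/-- **Conditional variance of the martingale differences of `Q[n] = πᵀ X[n]`.**
In the RA model, with `π` a positive left eigenvector of `T` for eigenvalue `1` normalized to
sum `1`, the martingale difference `ΔQ[n+1] = Q[n+1] - Q[n]` of `Q[n] = πᵀ X[n]` satisfies,
almost surely, `Var(ΔQ[n+1] | ℱ n) = E[(ΔQ[n+1])² | ℱ n] = α² ∑_k π_k² X_k[n](1 - X_k[n])`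
(this is the corrected form of the display, with time index shifted so that the conditioning
σ-algebra is `ℱ n = F_{(n+1)-1}`). -/
theorem RA_pi_cond_variance {K : ℕ} (hK : 1 ≤ K) {Ω : Type*} [MeasurableSpace Ω]
    {μ : Measure Ω} [IsProbabilityMeasure μ] (M : RAModel K Ω μ)
    (π : Fin K → ℝ) (hπ_pos : ∀ k, 0 < π k) (hπ_sum : ∑ k, π k = 1)
    (hπ_eig : ∀ j, ∑ i, π i * M.T i j = π j)
    (Qp : ℕ → Ω → ℝ) (hQp : ∀ n ω, Qp n ω = ∑ k, π k * M.X n ω k) :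
    ∀ n,
      ((fun ω => (μ[fun ω' => (Qp (n + 1) ω' - Qp n ω') ^ 2 | M.ℱ n]) ω
          - ((μ[fun ω' => Qp (n + 1) ω' - Qp n ω' | M.ℱ n]) ω) ^ 2)
        =ᵐ[μ] μ[fun ω' => (Qp (n + 1) ω' - Qp n ω') ^ 2 | M.ℱ n]) ∧
      (μ[fun ω' => (Qp (n + 1) ω' - Qp n ω') ^ 2 | M.ℱ n]
        =ᵐ[μ] fun ω => M.α ^ 2 * ∑ k, (π k) ^ 2 * (M.X n ω k * (1 - M.X n ω k))) := by
  intro n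
  have h_diff : (fun ω => Qp (n + 1) ω - Qp n ω)
      = fun ω => ∑ k, M.α * π k * M.noise n k ω := by
    ext ω
    rw [hQp, hQp, M.sum_opinion_succ_sub π hπ_eig]
  have h_sq : (fun ω => (Qp (n + 1) ω - Qp n ω) ^ 2)
      = fun ω => (∑ k, M.α * π k * M.noise n k ω) ^ 2 :=
    funext fun ω => congrArg (· ^ 2) (congrFun h_diff ω)
  rw [h_sq, h_diff]
  constructor
  · filter_upwards [M.condExp_sum_noise n fun k => M.α * π k] with ω h
    simp [h]
  · filter_upwards [M.condExp_sum_noise_sq n fun k => M.α * π k] with ω h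
    rw [h, Finset.mul_sum]
    exact Finset.sum_congr rfl fun k _ => by ring
end
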